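/- arXiv:2309.14270 — 6 statements merged into one kernel-verified Lean document; each statement's English description precedes it below -/
import Mathlib

section
/- Let A^μ_ν (μ,ν ∈ {1,…,n}) be a family of N×N complex matrices and let T(ν_1,…,ν_n) := Σ_{μ_1,…,μ_n} ε_{μ_1…μ_n} ⟨⟨A^{μ_1}_{ν_1}⋯A^{μ_n}_{ν_n}⟩⟩. Then for every function ν : {1,…,n} → {1,…,n} one has T(ν_1,…,ν_n) = ε_{ν_1…ν_n} · sdet A; in particular T vanishes whenever two of the ν-indices coincide, and T(π(1),…,π(n)) = sign(π) · sdet A for every permutation π. -/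
/-- The symmetrized product `⟨⟨A_1 ⋯ A_k⟩⟩ = (1/k!) ∑_{φ ∈ S_k} A_{φ(1)} ⋯ A_{φ(k)}`
of a family of `N × N` complex matrices. -/
noncomputable def symProd {N k : ℕ} (f : Fin k → Matrix (Fin N) (Fin N) ℂ) :
    Matrix (Fin N) (Fin N) ℂ :=
  ((Nat.factorial k : ℂ))⁻¹ • ∑ σ : Equiv.Perm (Fin k), (List.ofFn fun i => f (σ i)).prod

/-- The Levi-Civita symbol `ε_{μ_1 … μ_n}`: the sign of `(μ_1,…,μ_n)` as a permutation
of `(1,…,n)`, and `0` if any index repeats. -/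
noncomputable def levi {n : ℕ} (μ : Fin n → Fin n) : ℂ :=
  if h : Function.Bijective μ then ((Equiv.Perm.sign (Equiv.ofBijective μ h) : ℤ) : ℂ) else 0


/-- The symmetrized determinant of a matrix-valued (1,1)-tensor:
`sdet A := (1/n!) ∑ ε_{μ_1…μ_n} ε^{ν_1…ν_n} ⟨⟨A^{μ_1}_{ν_1} ⋯ A^{μ_n}_{ν_n}⟩⟩`. -/
noncomputable def sdet {N n : ℕ} (A : Fin n → Fin n → Matrix (Fin N) (Fin N) ℂ) :
    Matrix (Fin N) (Fin N) ℂ :=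
  ((Nat.factorial n : ℂ))⁻¹ • ∑ μ : Fin n → Fin n, ∑ ν : Fin n → Fin n,
    (levi μ * levi ν) • symProd (fun i => A (μ i) (ν i))

theorem symProd_comp_perm {N k : ℕ} (f : Fin k → Matrix (Fin N) (Fin N) ℂ)
    (π : Equiv.Perm (Fin k)) : symProd (fun i => f (π i)) = symProd f := by
  unfold symProd
  congr 1
  exact Equiv.sum_comp (Equiv.mulLeft π)
    fun σ : Equiv.Perm (Fin k) => (List.ofFn fun i => f (σ i)).prod

theorem levi_perm {n : ℕ} (π : Equiv.Perm (Fin n)) :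
    levi π = ((Equiv.Perm.sign π : ℤ) : ℂ) := by
  unfold levi
  rw [dif_pos π.bijective]
  congr 3
  ext i
  rfl

theorem levi_eq_zero {n : ℕ} {μ : Fin n → Fin n} (h : ¬ Function.Bijective μ) : levi μ = 0 :=
  dif_neg h

theorem levi_comp_perm {n : ℕ} (μ : Fin n → Fin n) (π : Equiv.Perm (Fin n)) :
    levi (μ ∘ π) = ((Equiv.Perm.sign π : ℤ) : ℂ) * levi μ := by
  by_cases h : Function.Bijective μ
  · obtain ⟨ρ, rfl⟩ : ∃ ρ : Equiv.Perm (Fin n), ⇑ρ = μ := ⟨Equiv.ofBijective μ h, rfl⟩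
    rw [← Equiv.Perm.coe_mul, levi_perm, levi_perm, Equiv.Perm.sign_mul]
    push_cast
    ring
  · rw [levi_eq_zero h, levi_eq_zero fun h' => h ((Equiv.bijective_comp π μ).1 h'), mul_zero]

theorem sum_levi_smul {M : Type*} [AddCommGroup M] [Module ℂ M] {n : ℕ}
    (F : (Fin n → Fin n) → M) :
    ∑ ν, levi ν • F ν =
      ∑ π : Equiv.Perm (Fin n), ((Equiv.Perm.sign π : ℤ) : ℂ) • F π := by
  refine (Fintype.sum_of_injective (fun π : Equiv.Perm (Fin n) => ⇑π) DFunLike.coe_injective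
    _ _ (fun ν hν => ?_) fun π => ?_).symm
  · rw [levi_eq_zero fun h => hν ⟨Equiv.ofBijective ν h, rfl⟩, zero_smul]
  · rw [levi_perm]

theorem sign_mul_self_complex {n : ℕ} (π : Equiv.Perm (Fin n)) :
    ((Equiv.Perm.sign π : ℤ) : ℂ) * ((Equiv.Perm.sign π : ℤ) : ℂ) = 1 := by
  rw [← Int.cast_mul, Int.units_coe_mul_self, Int.cast_one]

/-- Permuting the lower indices of `∑_μ ε_μ ⟨⟨A^{μ_1}_{ν_1} ⋯ A^{μ_n}_{ν_n}⟩⟩` multiplies it by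
the sign of the permutation. -/
theorem sum_levi_symProd_comp_perm {N n : ℕ} (A : Fin n → Fin n → Matrix (Fin N) (Fin N) ℂ)
    (ν : Fin n → Fin n) (π : Equiv.Perm (Fin n)) :
    ∑ μ : Fin n → Fin n, levi μ • symProd (fun i => A (μ i) (ν (π i))) =
      ((Equiv.Perm.sign π : ℤ) : ℂ) •
        ∑ μ : Fin n → Fin n, levi μ • symProd (fun i => A (μ i) (ν i)) := by
  rw [← Equiv.sum_comp (Equiv.arrowCongr π.symm (Equiv.refl (Fin n))), Finset.smul_sum]
  refine Finset.sum_congr rfl fun μ _ => ?_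
  rw [← symProd_comp_perm (fun i => A (μ i) (ν i)) π, smul_smul, ← levi_comp_perm]
  rfl

/-- The symmetrized determinant is `∑_μ ε_μ ⟨⟨A^{μ_1}_1 ⋯ A^{μ_n}_n⟩⟩`. -/
theorem sdet_eq_sum_levi {N n : ℕ} (A : Fin n → Fin n → Matrix (Fin N) (Fin N) ℂ) :
    sdet A = ∑ μ : Fin n → Fin n, levi μ • symProd (fun i => A (μ i) i) := by
  unfold sdet
  rw [Finset.sum_comm]
  simp_rw [mul_comm (levi _) (levi _), mul_smul, ← Finset.smul_sum]
  rw [sum_levi_smul]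
  have h (π : Equiv.Perm (Fin n)) := sum_levi_symProd_comp_perm A id π
  simp only [id] at h
  simp_rw [h, smul_smul, sign_mul_self_complex, one_smul]
  rw [Finset.sum_const, Finset.card_univ, Fintype.card_perm, Fintype.card_fin,
    ← Nat.cast_smul_eq_nsmul ℂ, smul_smul,
    inv_mul_cancel₀ (Nat.cast_ne_zero.2 n.factorial_ne_zero), one_smul]

/-- For `T(ν_1,…,ν_n) := ∑_μ ε_{μ_1…μ_n} ⟨⟨A^{μ_1}_{ν_1} ⋯ A^{μ_n}_{ν_n}⟩⟩` one has
`T(ν_1,…,ν_n) = ε_{ν_1…ν_n} ⋅ sdet A`; in particular `T` vanishes whenever two of the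
ν-indices coincide, and `T(π(1),…,π(n)) = sign(π) ⋅ sdet A` for every permutation `π`. -/
theorem T_eq_levi_smul_sdet {N n : ℕ} (A : Fin n → Fin n → Matrix (Fin N) (Fin N) ℂ)
    (T : (Fin n → Fin n) → Matrix (Fin N) (Fin N) ℂ)
    (hT : ∀ ν : Fin n → Fin n,
      T ν = ∑ μ : Fin n → Fin n, levi μ • symProd (fun i => A (μ i) (ν i))) :
    (∀ ν : Fin n → Fin n, T ν = levi ν • sdet A)
    ∧ (∀ ν : Fin n → Fin n, ∀ i j : Fin n, i ≠ j → ν i = ν j → T ν = 0)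
    ∧ (∀ π : Equiv.Perm (Fin n), T π = ((Equiv.Perm.sign π : ℤ) : ℂ) • sdet A) := by
  have hperm (π : Equiv.Perm (Fin n)) : T π = ((Equiv.Perm.sign π : ℤ) : ℂ) • sdet A := by
    rw [hT, sdet_eq_sum_levi]
    exact sum_levi_symProd_comp_perm A id π
  have hzero (ν : Fin n → Fin n) (i j : Fin n) (hij : i ≠ j) (hν : ν i = ν j) : T ν = 0 := by
    have hswap (k : Fin n) : ν (Equiv.swap i j k) = ν k := by
      rw [Equiv.swap_apply_def]
      split_ifs with h₁ h₂
      · rw [h₁, hν]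
      · rw [h₂, hν]
      · rfl
    have h := sum_levi_symProd_comp_perm A ν (Equiv.swap i j)
    simp only [hswap, ← hT, Equiv.Perm.sign_swap hij, Units.val_neg, Units.val_one, Int.cast_neg,
      Int.cast_one, neg_smul, one_smul] at h
    ext a b
    exact self_eq_neg.1 (congrFun (congrFun h a) b)
  refine ⟨fun ν => ?_, hzero, hperm⟩
  by_cases h : Function.Bijective ν
  · obtain ⟨π, rfl⟩ : ∃ π : Equiv.Perm (Fin n), ⇑π = ν := ⟨Equiv.ofBijective ν h, rfl⟩
    rw [hperm, levi_perm]
  · rw [levi_eq_zero h, zero_smul]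
    rw [← Finite.injective_iff_bijective, Function.Injective] at h
    push Not at h
    obtain ⟨i, j, hν, hij⟩ := h
    exact hzero ν i j hij hν
end

section
/- Let B^{μν} (μ,ν ∈ {1,…,n}) be a family of N×N complex matrices and J an invertible n×n real matrix. Define B'^{μν} := Σ_{α,β} J^μ_α J^ν_β B^{αβ}. Then sdet B' = (det J)^2 · sdet B, i.e. the symmetrized determinant of a matrix-valued (2,0)-tensor transforms as a scalar density of weight −2 under index transformations by scalar matrices. -/
/-- The symmetrized determinant of a matrix-valued (2,0)-tensor:
`sdet B := (1/n!) ∑ ε_{μ_1…μ_n} ε_{ν_1…ν_n} ⟨⟨B^{μ_1 ν_1} ⋯ B^{μ_n ν_n}⟩⟩`. -/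
noncomputable def sdetUp {N n : ℕ} (B : Fin n → Fin n → Matrix (Fin N) (Fin N) ℂ) :
    Matrix (Fin N) (Fin N) ℂ :=
  ((Nat.factorial n : ℂ))⁻¹ • ∑ μ : Fin n → Fin n, ∑ ν : Fin n → Fin n,
    (levi μ * levi ν) • symProd (fun i => B (μ i) (ν i))

/-- The symmetrized product as a multilinear map. -/
noncomputable def symProdMultilinear (N k : ℕ) :
    MultilinearMap ℂ (fun _ : Fin k => Matrix (Fin N) (Fin N) ℂ) (Matrix (Fin N) (Fin N) ℂ) :=
  ((Nat.factorial k : ℂ))⁻¹ • ∑ σ : Equiv.Perm (Fin k),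
    (MultilinearMap.mkPiAlgebraFin ℂ k (Matrix (Fin N) (Fin N) ℂ)).domDomCongr σ

theorem symProdMultilinear_apply {N k : ℕ} (f : Fin k → Matrix (Fin N) (Fin N) ℂ) :
    symProdMultilinear N k f = symProd f := by
  simp [symProdMultilinear, symProd]

theorem symProd_sum_sum_smul {N k : ℕ} {ι κ : Type*} [Fintype ι] [Fintype κ]
    (a : Fin k → ι → ℂ) (b : Fin k → κ → ℂ) (B : ι → κ → Matrix (Fin N) (Fin N) ℂ) :
    symProd (fun i => ∑ α, ∑ β, (a i α * b i β) • B α β) =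
      ∑ α : Fin k → ι, ∑ β : Fin k → κ,
        ((∏ i, a i (α i)) * ∏ i, b i (β i)) • symProd (fun i => B (α i) (β i)) := by
  classical
  simp only [← symProdMultilinear_apply, MultilinearMap.map_sum, MultilinearMap.map_smul_univ,
    Finset.prod_mul_distrib]

theorem levi_coe {n : ℕ} (σ : Equiv.Perm (Fin n)) :
    levi σ = ((Equiv.Perm.sign σ : ℤ) : ℂ) := by
  have h : Equiv.ofBijective σ σ.bijective = σ := by ext; rfl
  rw [levi, dif_pos σ.bijective, h]

/-- A sum weighted by the Levi-Civita symbol is a signed sum over permutations. -/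
theorem sum_levi_mul {n : ℕ} (g : (Fin n → Fin n) → ℂ) :
    ∑ μ, levi μ * g μ = ∑ σ : Equiv.Perm (Fin n), ((Equiv.Perm.sign σ : ℤ) : ℂ) * g σ := by
  simp only [← levi_coe]
  refine (Finset.sum_of_injOn (fun σ : Equiv.Perm (Fin n) => (σ : Fin n → Fin n))
    DFunLike.coe_injective.injOn (by simp) ?_ (fun _ _ => rfl)).symm
  intro μ _ hμ
  rw [levi, dif_neg, zero_mul]
  exact fun h => hμ ⟨Equiv.ofBijective μ h, by simp, rfl⟩

/-- Contracting the Levi-Civita symbol with the columns `α` of `J` gives `levi α * det J`. -/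
theorem sum_levi_mul_prod {n : ℕ} (J : Matrix (Fin n) (Fin n) ℂ) (α : Fin n → Fin n) :
    ∑ μ, levi μ * ∏ i, J (μ i) (α i) = levi α * J.det := by
  have h : ∑ μ, levi μ * ∏ i, J (μ i) (α i) = (J.submatrix id α).det := by
    rw [sum_levi_mul, Matrix.det_apply']
    rfl
  rw [h]
  by_cases hα : Function.Bijective α
  · obtain ⟨σ, rfl⟩ : ∃ σ : Equiv.Perm (Fin n), ⇑σ = α := ⟨Equiv.ofBijective α hα, rfl⟩
    rw [Matrix.det_permute', levi_coe]
  · rw [levi, dif_neg hα, zero_mul]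
    obtain ⟨i, j, hij, hne⟩ := Function.not_injective_iff.mp
      (mt Finite.injective_iff_bijective.mp hα)
    exact Matrix.det_zero_of_column_eq hne fun k => by simp [hij]

/-- The transformation law of the symmetrized determinant under a complex matrix. -/
theorem sdetUp_transform {N n : ℕ} (B : Fin n → Fin n → Matrix (Fin N) (Fin N) ℂ)
    (J : Matrix (Fin n) (Fin n) ℂ) :
    sdetUp (fun μ ν => ∑ α, ∑ β, (J μ α * J ν β) • B α β) = (J.det ^ 2) • sdetUp B := by
  have key (α β : Fin n → Fin n) :
      ∑ μ : Fin n → Fin n, ∑ ν : Fin n → Fin n,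
        levi μ * levi ν * ((∏ i, J (μ i) (α i)) * ∏ i, J (ν i) (β i)) =
      J.det ^ 2 * (levi α * levi β) := by
    calc _ = (∑ μ, levi μ * ∏ i, J (μ i) (α i)) * ∑ ν, levi ν * ∏ i, J (ν i) (β i) := by
          rw [Finset.sum_mul_sum]
          refine Finset.sum_congr rfl fun μ _ => Finset.sum_congr rfl fun ν _ => ?_
          ring
      _ = _ := by
          rw [sum_levi_mul_prod, sum_levi_mul_prod]
          ring
  rw [sdetUp, sdetUp, smul_comm]
  congr 1
  calc _ = ∑ μ : Fin n → Fin n, ∑ ν : Fin n → Fin n, ∑ α : Fin n → Fin n, ∑ β : Fin n → Fin n,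
        (levi μ * levi ν * ((∏ i, J (μ i) (α i)) * ∏ i, J (ν i) (β i))) •
          symProd (fun i => B (α i) (β i)) := by
        refine Finset.sum_congr rfl fun μ _ => Finset.sum_congr rfl fun ν _ => ?_
        rw [symProd_sum_sum_smul (fun i => J (μ i)) (fun i => J (ν i))]
        simp only [Finset.smul_sum, smul_smul]
    _ = ∑ α : Fin n → Fin n, ∑ β : Fin n → Fin n, ∑ μ : Fin n → Fin n, ∑ ν : Fin n → Fin n,
        (levi μ * levi ν * ((∏ i, J (μ i) (α i)) * ∏ i, J (ν i) (β i))) •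
          symProd (fun i => B (α i) (β i)) := by
        rw [Finset.sum_congr rfl fun μ _ => Finset.sum_comm, Finset.sum_comm]
        refine Finset.sum_congr rfl fun α _ => ?_
        rw [Finset.sum_congr rfl fun μ _ => Finset.sum_comm, Finset.sum_comm]
    _ = _ := by
        simp only [← Finset.sum_smul, key, Finset.smul_sum, smul_smul]

/-- The symmetrized determinant of a matrix-valued (2,0)-tensor transforms as a scalar
density of weight `−2`: if `B'^{μν} = ∑_{α,β} J^μ_α J^ν_β B^{αβ}` then
`sdet B' = (det J)² ⋅ sdet B`. -/
theorem sdetUp_density {N n : ℕ}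
    (B : Fin n → Fin n → Matrix (Fin N) (Fin N) ℂ)
    (J : Matrix (Fin n) (Fin n) ℝ) (hJ : IsUnit J) :
    sdetUp (fun μ ν => ∑ α : Fin n, ∑ β : Fin n, (J μ α * J ν β) • B α β)
      = (J.det ^ 2) • sdetUp B := by
  have hdet : (J.map Complex.ofReal).det = (J.det : ℂ) :=
    (RingHom.map_det Complex.ofRealHom J).symm
  have h := sdetUp_transform B (J.map Complex.ofReal)
  simpa only [hdet, Matrix.map_apply, ← Complex.ofReal_mul, ← Complex.ofReal_pow,
    Complex.coe_smul] using h
end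

section
/- Let a^{αβ}, θ^α_{λμ}, and D^{αβ}_μ be families of N×N complex matrices indexed by α,β,λ,μ ∈ {1,…,n} such that: (a^{αβ})* = a^{αβ} and a^{αβ} = a^{βα}; (θ^α_{λμ})* = θ^α_{λμ}; (D^{αβ}_μ)* = D^{αβ}_μ and D^{αβ}_μ = D^{βα}_μ. Let c₁, c₂ be real numbers and suppose that for all α,β,μ the compatibility condition holds: D^{αβ}_μ + c₁ Σ_λ θ^α_{λμ} a^{λβ} + c₂ Σ_λ θ^β_{λμ} a^{αλ} + (1−c₁) Σ_λ a^{λβ} θ^α_{λμ} + (1−c₂) Σ_λ a^{αλ} θ^β_{λμ} = 0. Define S^{αβ}_μ := ½ Σ_λ [a^{βλ}, θ^α_{λμ}] (commutator). Then for all α,β,μ: (c₁−c₂)(S^{αβ}_μ − S^{βα}_μ) = 0 and (2c₁−1) S^{αβ}_μ + (2c₂−1) S^{βα}_μ = 0. -/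
open Matrix

/-- Given a self-adjoint symmetric `a^{αβ}`, a self-adjoint `θ^α_{λμ}`, and a
self-adjoint symmetric `D^{αβ}_μ` satisfying the compatibility condition
`D^{αβ}_μ + c₁ θ^α_{λμ} a^{λβ} + c₂ θ^β_{λμ} a^{αλ}
  + (1−c₁) a^{λβ} θ^α_{λμ} + (1−c₂) a^{αλ} θ^β_{λμ} = 0`,
the tensor `S^{αβ}_μ := ½ [a^{βλ}, θ^α_{λμ}]` satisfies
`(c₁−c₂)(S^{αβ}_μ − S^{βα}_μ) = 0` and `(2c₁−1) S^{αβ}_μ + (2c₂−1) S^{βα}_μ = 0`. -/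
theorem compat_S_constraints {N n : ℕ}
    (a : Fin n → Fin n → Matrix (Fin N) (Fin N) ℂ)
    (θ : Fin n → Fin n → Fin n → Matrix (Fin N) (Fin N) ℂ)
    (D : Fin n → Fin n → Fin n → Matrix (Fin N) (Fin N) ℂ)
    (ha_adj : ∀ α β, (a α β)ᴴ = a α β)
    (ha_sym : ∀ α β, a α β = a β α)
    (hθ_adj : ∀ α lam μ, (θ α lam μ)ᴴ = θ α lam μ)
    (hD_adj : ∀ α β μ, (D α β μ)ᴴ = D α β μ)
    (hD_sym : ∀ α β μ, D α β μ = D β α μ)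
    (c₁ c₂ : ℝ)
    (hcompat : ∀ α β μ,
      D α β μ
      + c₁ • (∑ lam : Fin n, θ α lam μ * a lam β)
      + c₂ • (∑ lam : Fin n, θ β lam μ * a α lam)
      + (1 - c₁) • (∑ lam : Fin n, a lam β * θ α lam μ)
      + (1 - c₂) • (∑ lam : Fin n, a α lam * θ β lam μ) = 0)
    (S : Fin n → Fin n → Fin n → Matrix (Fin N) (Fin N) ℂ)
    (hS : ∀ α β μ, S α β μ
      = ((2 : ℂ))⁻¹ • ∑ lam : Fin n, (a β lam * θ α lam μ - θ α lam μ * a β lam)) :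
    ∀ α β μ, (c₁ - c₂) • (S α β μ - S β α μ) = 0
      ∧ (2 * c₁ - 1) • S α β μ + (2 * c₂ - 1) • S β α μ = 0 := by
  intro α β μ
  set P : Fin n → Fin n → Matrix (Fin N) (Fin N) ℂ :=
    fun α β => ∑ lam : Fin n, θ α lam μ * a lam β with hP
  set Q : Fin n → Fin n → Matrix (Fin N) (Fin N) ℂ :=
    fun α β => ∑ lam : Fin n, a lam β * θ α lam μ with hQ
  have hPQ : ∀ α β, (P α β)ᴴ = Q α β := fun α β => by
    simp [hP, hQ, conjTranspose_sum, conjTranspose_mul, ha_adj, hθ_adj]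
  have hQP : ∀ α β, (Q α β)ᴴ = P α β := fun α β => by
    rw [← hPQ, conjTranspose_conjTranspose]
  have hSPQ : ∀ α β, S α β μ = (2 : ℝ)⁻¹ • (Q α β - P α β) := fun α β => by
    have h2 : (2 : ℂ)⁻¹ = (((2 : ℝ)⁻¹ : ℝ) : ℂ) := by norm_num
    rw [hS, Finset.sum_sub_distrib, h2, Complex.coe_smul]
    simp only [hP, hQ, ha_sym β]
  have hc : ∀ α β, D α β μ + c₁ • P α β + c₂ • P β α
      + (1 - c₁) • Q α β + (1 - c₂) • Q β α = 0 := fun α β => by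
    simpa only [hP, hQ, ha_sym α] using hcompat α β μ
  have hc_adj : D α β μ + c₁ • Q α β + c₂ • Q β α
      + (1 - c₁) • P α β + (1 - c₂) • P β α = 0 := by
    simpa only [conjTranspose_add, conjTranspose_smul, conjTranspose_zero, hPQ, hQP, hD_adj,
      star_trivial] using congrArg conjTranspose (hc α β)
  have hc_swap := hc β α
  rw [hD_sym β α] at hc_swap
  rw [hSPQ, hSPQ]
  constructor
  · linear_combination (norm := module) (2 : ℝ)⁻¹ • hc_swap - (2 : ℝ)⁻¹ • hc α β
  · linear_combination (norm := module) (2 : ℝ)⁻¹ • hc_adj - (2 : ℝ)⁻¹ • hc α β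
end

section
/- Let a^{αβ}, θ^α_{λμ}, and D^{αβ}_μ be families of N×N complex matrices indexed by α,β,λ,μ ∈ {1,…,n} such that: (a^{αβ})* = a^{αβ} and a^{αβ} = a^{βα}; (θ^α_{λμ})* = θ^α_{λμ}; (D^{αβ}_μ)* = D^{αβ}_μ and D^{αβ}_μ = D^{βα}_μ. Let c₁, c₂ be real numbers with c₁ ≠ c₂ and c₁ + c₂ ≠ 1, and suppose that for all α,β,μ: D^{αβ}_μ + c₁ Σ_λ θ^α_{λμ} a^{λβ} + c₂ Σ_λ θ^β_{λμ} a^{αλ} + (1−c₁) Σ_λ a^{λβ} θ^α_{λμ} + (1−c₂) Σ_λ a^{αλ} θ^β_{λμ} = 0. Then Σ_λ [a^{βλ}, θ^α_{λμ}] = 0 for all α,β,μ. -/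
open Matrix

/-- Given a self-adjoint symmetric `a^{αβ}`, a self-adjoint `θ^α_{λμ}`, and a
self-adjoint symmetric `D^{αβ}_μ` satisfying the compatibility condition
`D^{αβ}_μ + c₁ θ^α_{λμ} a^{λβ} + c₂ θ^β_{λμ} a^{αλ}
  + (1−c₁) a^{λβ} θ^α_{λμ} + (1−c₂) a^{αλ} θ^β_{λμ} = 0`
with `c₁ ≠ c₂` and `c₁ + c₂ ≠ 1`, one has `∑_λ [a^{βλ}, θ^α_{λμ}] = 0`. -/
theorem compat_commutator_vanishes {N n : ℕ}
    (a : Fin n → Fin n → Matrix (Fin N) (Fin N) ℂ)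
    (θ : Fin n → Fin n → Fin n → Matrix (Fin N) (Fin N) ℂ)
    (D : Fin n → Fin n → Fin n → Matrix (Fin N) (Fin N) ℂ)
    (ha_adj : ∀ α β, (a α β)ᴴ = a α β)
    (ha_sym : ∀ α β, a α β = a β α)
    (hθ_adj : ∀ α lam μ, (θ α lam μ)ᴴ = θ α lam μ)
    (hD_adj : ∀ α β μ, (D α β μ)ᴴ = D α β μ)
    (hD_sym : ∀ α β μ, D α β μ = D β α μ)
    (c₁ c₂ : ℝ) (hc : c₁ ≠ c₂) (hc' : c₁ + c₂ ≠ 1)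
    (hcompat : ∀ α β μ,
      D α β μ
      + c₁ • (∑ lam : Fin n, θ α lam μ * a lam β)
      + c₂ • (∑ lam : Fin n, θ β lam μ * a α lam)
      + (1 - c₁) • (∑ lam : Fin n, a lam β * θ α lam μ)
      + (1 - c₂) • (∑ lam : Fin n, a α lam * θ β lam μ) = 0) :
    ∀ α β μ, ∑ lam : Fin n, (a β lam * θ α lam μ - θ α lam μ * a β lam) = 0 := by
  intro α β μ
  set X : Fin n → Fin n → Matrix (Fin N) (Fin N) ℂ :=
    fun α β => ∑ lam, θ α lam μ * a lam β with hX
  set Y : Fin n → Fin n → Matrix (Fin N) (Fin N) ℂ :=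
    fun α β => ∑ lam, a lam β * θ α lam μ with hY
  have hXY : ∀ α β, (X α β)ᴴ = Y α β := fun α β => by
    simp [hX, hY, conjTranspose_sum, ha_adj, hθ_adj]
  have hYX : ∀ α β, (Y α β)ᴴ = X α β := fun α β => by
    rw [← hXY, conjTranspose_conjTranspose]
  have compat : ∀ α β, D α β μ + c₁ • X α β + c₂ • X β α
      + (1 - c₁) • Y α β + (1 - c₂) • Y β α = 0 := fun α β => by
    simpa only [hX, hY, ha_sym _ α] using hcompat α β μ
  have compat_adj : ∀ α β, D α β μ + c₁ • Y α β + c₂ • Y β α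
      + (1 - c₁) • X α β + (1 - c₂) • X β α = 0 := fun α β => by
    simpa only [conjTranspose_add, conjTranspose_smul, star_trivial, hXY, hYX, hD_adj,
      conjTranspose_zero] using congrArg conjTranspose (compat α β)
  have skew : ∀ α β, (2 * c₁ - 1) • (Y α β - X α β) + (2 * c₂ - 1) • (Y β α - X β α) = 0 :=
    fun α β => by linear_combination (norm := module) compat_adj α β - compat α β
  have key : (4 * ((c₁ - c₂) * (c₁ + c₂ - 1))) • (Y α β - X α β) = 0 := by
    linear_combination (norm := module) (2 * c₁ - 1) • skew α β - (2 * c₂ - 1) • skew β α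
  have hdet : 4 * ((c₁ - c₂) * (c₁ + c₂ - 1)) ≠ 0 :=
    mul_ne_zero four_ne_zero (mul_ne_zero (sub_ne_zero.2 hc) (sub_ne_zero.2 hc'))
  simpa only [hX, hY, ← Finset.sum_sub_distrib, ha_sym _ β] using
    (smul_eq_zero.1 key).resolve_left hdet
end

section
/- Let n be a natural number, g : {1,…,n}×{1,…,n} → ℝ a symmetric array, h_{αβ} a symmetric family of N×N complex matrices, and D_μ (μ ∈ {1,…,n}) a family of derivations on the algebra of N×N complex matrices (linear maps with D_μ(XY) = (D_μX)Y + X(D_μY)). Define h^{αβ} := Σ g^{αγ} g^{βδ} h_{γδ}, the trace h := Σ g^{αβ} h_{αβ}, Φ₁ := −½ h, Φ₂ := (1/8) h∘h + ¼ Σ_{α,β} h_{αβ} ∘ h^{αβ}, θ_{(1),μ} := −½ D_μ h, and θ_{(2),μ} := ½ Σ_{α,β} h^{αβ} ∘ D_μ h_{αβ}, where X∘Y := ½(XY+YX). Then for every μ: D_μ Φ₁ = θ_{(1),μ} and D_μ Φ₂ = θ_{(1),μ} ∘ Φ₁ + θ_{(2),μ}. (This is the statement that the symmetrized-determinant density Φ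 satisfies ∇_μ Φ − θ_μ ∘ Φ = O(κ³) through second order in perturbation theory.) -/
open Matrix

/-- The symmetrized (Jordan) product `X ∘ Y := ½ (XY + YX)` of matrices. -/
noncomputable def jordan {N : ℕ} (X Y : Matrix (Fin N) (Fin N) ℂ) :
    Matrix (Fin N) (Fin N) ℂ :=
  ((2 : ℂ))⁻¹ • (X * Y + Y * X)

theorem jordan_comm {N : ℕ} (X Y : Matrix (Fin N) (Fin N) ℂ) : jordan X Y = jordan Y X := by
  simp only [jordan, add_comm]

theorem jordan_neg_smul_neg_smul {N : ℕ} (a b : ℂ) (X Y : Matrix (Fin N) (Fin N) ℂ) :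
    jordan (-(a • X)) (-(b • Y)) = (a * b) • jordan X Y := by
  simp only [jordan, neg_mul_neg, smul_mul_smul_comm, mul_comm b a, ← smul_add]
  rw [smul_comm]

theorem jordan_real_smul_left {N : ℕ} (r : ℝ) (X Y : Matrix (Fin N) (Fin N) ℂ) :
    jordan (r • X) Y = r • jordan X Y := by
  simp only [jordan, smul_mul_assoc, mul_smul_comm, ← smul_add]
  rw [smul_comm]

theorem jordan_sum_left {N : ℕ} {ι : Type*} (s : Finset ι)
    (f : ι → Matrix (Fin N) (Fin N) ℂ) (Y : Matrix (Fin N) (Fin N) ℂ) :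
    jordan (∑ i ∈ s, f i) Y = ∑ i ∈ s, jordan (f i) Y := by
  simp only [jordan, Finset.sum_mul, Finset.mul_sum, ← Finset.sum_add_distrib, Finset.smul_sum]

/-- A derivation for the matrix product is a derivation for the Jordan product. -/
theorem map_jordan {N : ℕ} (D : Matrix (Fin N) (Fin N) ℂ →ₗ[ℂ] Matrix (Fin N) (Fin N) ℂ)
    (hD : ∀ X Y, D (X * Y) = D X * Y + X * D Y) (X Y : Matrix (Fin N) (Fin N) ℂ) :
    D (jordan X Y) = jordan (D X) Y + jordan X (D Y) := by
  simp only [jordan, map_smul, map_add, hD, ← smul_add]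
  congr 1
  abel

/-- Raising both indices with a symmetric array is self-adjoint for the contraction
`∑ A_{αβ} ∘ B_{αβ}`. -/
theorem sum_jordan_raise {N n : ℕ} (g : Fin n → Fin n → ℝ) (hg : ∀ α β, g α β = g β α)
    (A B : Fin n → Fin n → Matrix (Fin N) (Fin N) ℂ) :
    ∑ α, ∑ β, jordan (∑ γ, ∑ δ, (g α γ * g β δ) • A γ δ) (B α β) =
      ∑ α, ∑ β, jordan (∑ γ, ∑ δ, (g α γ * g β δ) • B γ δ) (A α β) := by
  simp only [jordan_sum_left, jordan_real_smul_left, ← Fintype.sum_prod_type']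
  refine Fintype.sum_equiv ⟨fun x => (x.2.2.1, x.2.2.2, x.1, x.2.1),
    fun x => (x.2.2.1, x.2.2.2, x.1, x.2.1), fun _ => rfl, fun _ => rfl⟩ _ _ fun x => ?_
  simp only [Equiv.coe_fn_mk]
  rw [hg x.1, hg x.2.1, jordan_comm]

/-- With `h^{αβ} := ∑ g^{αγ} g^{βδ} h_{γδ}`, the trace `h := ∑ g^{αβ} h_{αβ}`,
`Φ₁ := −½ h`, `Φ₂ := ⅛ h∘h + ¼ ∑ h_{αβ} ∘ h^{αβ}`, `θ_{(1),μ} := −½ D_μ h`, and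
`θ_{(2),μ} := ½ ∑ h^{αβ} ∘ D_μ h_{αβ}`, one has `D_μ Φ₁ = θ_{(1),μ}` and
`D_μ Φ₂ = θ_{(1),μ} ∘ Φ₁ + θ_{(2),μ}` for every family `D_μ` of derivations; this is the
statement that `Φ` satisfies `∇_μ Φ − θ_μ ∘ Φ = O(κ³)` through second order. -/
theorem Phi_equation_second_order {N n : ℕ}
    (g : Fin n → Fin n → ℝ)
    (hg : ∀ α β, g α β = g β α)
    (h : Fin n → Fin n → Matrix (Fin N) (Fin N) ℂ)
    (hh : ∀ α β, h α β = h β α)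
    (D : Fin n → (Matrix (Fin N) (Fin N) ℂ →ₗ[ℂ] Matrix (Fin N) (Fin N) ℂ))
    (hD : ∀ μ (X Y : Matrix (Fin N) (Fin N) ℂ),
      D μ (X * Y) = D μ X * Y + X * D μ Y)
    (hup : Fin n → Fin n → Matrix (Fin N) (Fin N) ℂ)
    (hhup : ∀ α β, hup α β = ∑ γ : Fin n, ∑ δ : Fin n, (g α γ * g β δ) • h γ δ)
    (htr Φ₁ Φ₂ : Matrix (Fin N) (Fin N) ℂ)
    (hhtr : htr = ∑ α : Fin n, ∑ β : Fin n, g α β • h α β)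
    (hΦ₁ : Φ₁ = -(((2 : ℂ))⁻¹ • htr))
    (hΦ₂ : Φ₂ = ((8 : ℂ))⁻¹ • jordan htr htr
      + ((4 : ℂ))⁻¹ • ∑ α : Fin n, ∑ β : Fin n, jordan (h α β) (hup α β))
    (θ₁ θ₂ : Fin n → Matrix (Fin N) (Fin N) ℂ)
    (hθ₁ : ∀ μ, θ₁ μ = -(((2 : ℂ))⁻¹ • D μ htr))
    (hθ₂ : ∀ μ, θ₂ μ = ((2 : ℂ))⁻¹ •
      ∑ α : Fin n, ∑ β : Fin n, jordan (hup α β) (D μ (h α β))) :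
    ∀ μ, D μ Φ₁ = θ₁ μ ∧ D μ Φ₂ = jordan (θ₁ μ) Φ₁ + θ₂ μ := by
  intro μ
  have hDup (α β : Fin n) : D μ (hup α β) =
      ∑ γ : Fin n, ∑ δ : Fin n, (g α γ * g β δ) • D μ (h γ δ) := by
    simp only [hhup, map_sum, LinearMap.map_smul_of_tower]
  have hcontr : ∑ α, ∑ β, jordan (h α β) (D μ (hup α β)) =
      ∑ α, ∑ β, jordan (hup α β) (D μ (h α β)) := by
    simp only [jordan_comm (h _ _), hDup]
    simp only [hhup]
    exact sum_jordan_raise g hg (fun α β => D μ (h α β)) h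
  refine ⟨by rw [hΦ₁, hθ₁, map_neg, map_smul], ?_⟩
  rw [hΦ₂, hθ₁, hθ₂, hΦ₁, jordan_neg_smul_neg_smul]
  simp only [map_add, map_smul, map_sum, map_jordan (D μ) (hD μ), Finset.sum_add_distrib,
    hcontr, jordan_comm htr, jordan_comm (D μ (h _ _))]
  module
end

section
/- Let p : {1,2,3} → ℝ and define the real array θ^α{}_{βγ} indexed by α,β,γ ∈ {0,1,2,3} as follows (Latin indices i,j,k run over 1,2,3 and δ denotes the Kronecker delta): θ^0{}_{00} = 0, θ^0{}_{ij} = 0, θ^i{}_{j0} = θ^i{}_{0j} = 0 for i ≠ those listed, θ^0{}_{0i} = θ^0{}_{i0} = ½ p_i, θ^i{}_{00} = ½ p_i, and θ^i{}_{jk} = ½( p_i δ_{jk} − p_j δ_{ik} − p_k δ_{ij} ). Let η^{μν} = diag(−1,1,1,1) and define θ_γ := Σ_α θ^α{}_{αγ} and Θ := Σ_{β,ν} η^{βν} ( Σ_γ θ_γ θ^γ{}_{νβ} − Σ_{μ,γ} θ^μ{}_{γν} θ^γ{}_{μβ} ). Then Θ = ½ Σ_{i=1}^{3} p_i², i.e.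 in the static weak field limit the MOND scalar of the noncommutative connection equals Θ = ½|∇ψ|² where p_i plays the role of the partial derivatives ψ_{,i}. -/
/-- The Kronecker delta on `Fin 4`. -/
def kdelta (x y : Fin 4) : ℝ := if x = y then 1 else 0

/-- The inverse Minkowski metric `η^{μν} = diag(−1,1,1,1)` on indices `0,1,2,3`. -/
def eta (μ ν : Fin 4) : ℝ :=
  if μ = ν then (if μ = 0 then -1 else 1) else 0

/-- Extension of `p : {1,2,3} → ℝ` to indices `0,1,2,3`, with `q 0 = 0` and
`q i = p i` for spatial `i`. -/
def qext (p : Fin 3 → ℝ) : Fin 4 → ℝ := Fin.cons 0 p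

/-- The first-order connection perturbation of the static weak field limit:
`θ^0_{00} = 0`, `θ^0_{ij} = 0`, `θ^i_{j0} = θ^i_{0j} = 0`,
`θ^0_{0i} = θ^0_{i0} = ½ p_i`, `θ^i_{00} = ½ p_i`, and
`θ^i_{jk} = ½ (p_i δ_{jk} − p_j δ_{ik} − p_k δ_{ij})` for spatial `i,j,k`. -/
noncomputable def thetaWF (p : Fin 3 → ℝ) (α β γ : Fin 4) : ℝ :=
  if α = 0 then
    (if β = 0 then (2 : ℝ)⁻¹ * qext p γ
     else if γ = 0 then (2 : ℝ)⁻¹ * qext p β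
     else 0)
  else
    (if β = 0 then (if γ = 0 then (2 : ℝ)⁻¹ * qext p α else 0)
     else if γ = 0 then 0
     else (2 : ℝ)⁻¹ * (qext p α * kdelta β γ - qext p β * kdelta α γ
        - qext p γ * kdelta α β))

/-- The contracted connection `θ_γ := ∑_α θ^α{}_{αγ}`. -/
noncomputable def thetaC (p : Fin 3 → ℝ) (γ : Fin 4) : ℝ :=
  ∑ α : Fin 4, thetaWF p α α γ

/-- The MOND scalar
`Θ := ∑_{β,ν} η^{βν} ( ∑_γ θ_γ θ^γ{}_{νβ} − ∑_{μ,γ} θ^μ{}_{γν} θ^γ{}_{μβ} )`. -/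
noncomputable def ThetaWF (p : Fin 3 → ℝ) : ℝ :=
  ∑ β : Fin 4, ∑ ν : Fin 4, eta β ν *
    ((∑ γ : Fin 4, thetaC p γ * thetaWF p γ ν β)
      - ∑ μ : Fin 4, ∑ γ : Fin 4, thetaWF p μ γ ν * thetaWF p γ μ β)

/-- The contracted connection is `θ_γ = -p_γ`, with vanishing time component. -/
theorem thetaC_eq_neg_qext (p : Fin 3 → ℝ) (γ : Fin 4) : thetaC p γ = -qext p γ := by
  have h0 : qext p 0 = 0 := rfl
  fin_cases γ <;> simp [thetaC, thetaWF, kdelta, Fin.sum_univ_four, h0] <;> ring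

/-- In the static weak field limit the MOND scalar of the noncommutative connection
equals `Θ = ½ |∇ψ|² = ½ ∑_i p_i²`, with `p_i` playing the role of `ψ_{,i}`. -/
theorem ThetaWF_eq (p : Fin 3 → ℝ) :
    ThetaWF p = (2 : ℝ)⁻¹ * ∑ i : Fin 3, p i ^ 2 := by
  have h0 : qext p 0 = 0 := rfl
  have h1 : qext p 1 = p 0 := rfl
  have h2 : qext p 2 = p 1 := rfl
  have h3 : qext p 3 = p 2 := rfl
  simp [ThetaWF, thetaC_eq_neg_qext, eta, thetaWF, kdelta, Fin.sum_univ_four,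
    Fin.sum_univ_three, h0, h1, h2, h3]
  ring
end
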